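/- The infinite word z = h^ω(0), fixed point of h: 0↦001, 1↦011, avoids 2-binomial cubes: for every n ∈ ℕ, no factor (contiguous subword) of h^n(0) is a 2-binomial cube. -/

import Mathlib

/-- Number of occurrences of `v` as a scattered subword (subsequence) of `u`. -/
def binomC {α : Type*} [DecidableEq α] (u v : List α) : ℕ := u.sublists.count v

/-- Two words are 2-binomially equivalent. -/
def binEq2 {α : Type*} [DecidableEq α] (u v : List α) : Prop :=
  ∀ x : List α, x.length ≤ 2 → binomC u x = binomC v x

/-- The morphism h : 0 ↦ 001, 1 ↦ 011. -/
def h : Fin 2 → List (Fin 2) := ![[0,0,1],[0,1,1]]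

/-- Apply the morphism h to a word. -/
def hWord (w : List (Fin 2)) : List (Fin 2) := w.flatMap h

/-- The prefix h^n(0) of the fixed point z = h^ω(0). -/
def hPow (n : ℕ) : List (Fin 2) := hWord^[n] [0]

section BinomialCoefficients

variable {α : Type*} [DecidableEq α]

theorem binomC_nil_right (u : List α) : binomC u [] = 1 := by
  induction u with
  | nil => simp [binomC]
  | cons a u ih =>
    unfold binomC at *
    rw [(List.sublists_perm_sublists' _).count_eq] at *
    rw [List.sublists'_cons, List.count_append, ih, List.count_eq_zero_of_not_mem]
    simp

theorem binomC_nil_cons (b : α) (v : List α) : binomC [] (b :: v) = 0 := by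
  simp [binomC]

theorem binomC_cons_cons (a b : α) (u v : List α) :
    binomC (a :: u) (b :: v) = binomC u (b :: v) + if a = b then binomC u v else 0 := by
  unfold binomC
  simp only [(List.sublists_perm_sublists' _).count_eq]
  rw [List.sublists'_cons, List.count_append]
  congr 1
  split_ifs with hab
  · subst hab
    exact List.count_map_of_injective _ _ List.cons_injective _
  · rw [List.count_eq_zero_of_not_mem]
    simp [hab]

end BinomialCoefficients

/-- The number of `0`s minus the number of `1`s in a binary word. -/
def letterBalance (u : List (Fin 2)) : ℤ := binomC u [0] - binomC u [1]

/-- The sum over the positions of a binary word, counted with sign `1` at the letter `0` and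
sign `-1` at the letter `1`. -/
def positionBalance (u : List (Fin 2)) : ℤ :=
  binomC u [0, 0] + binomC u [1, 0] - binomC u [0, 1] - binomC u [1, 1]

/-- The sign `1` of the letter `0` and the sign `-1` of the letter `1`. -/
def letterSign (a : Fin 2) : ℤ := if a = 0 then 1 else -1

theorem letterSign_zero : letterSign 0 = 1 := rfl

theorem letterSign_one : letterSign 1 = -1 := rfl

theorem letterBalance_cons (a : Fin 2) (u : List (Fin 2)) :
    letterBalance (a :: u) = letterSign a + letterBalance u := by
  fin_cases a <;>
    simp [letterBalance, letterSign, binomC_cons_cons, binomC_nil_right] <;> ring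

theorem positionBalance_cons (a : Fin 2) (u : List (Fin 2)) :
    positionBalance (a :: u) = positionBalance u + letterBalance u := by
  fin_cases a <;>
    simp [letterBalance, positionBalance, binomC_cons_cons] <;> ring

theorem length_eq_binomC_add (u : List (Fin 2)) : u.length = binomC u [0] + binomC u [1] := by
  induction u with
  | nil => simp [binomC_nil_cons]
  | cons a u ih =>
    fin_cases a <;> simp [binomC_cons_cons, binomC_nil_right, ih] <;> ring

namespace binEq2

variable {u v : List (Fin 2)}

theorem length_eq (huv : binEq2 u v) : u.length = v.length := by
  rw [length_eq_binomC_add, length_eq_binomC_add, huv [0] (by simp), huv [1] (by simp)]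

theorem letterBalance_eq (huv : binEq2 u v) : letterBalance u = letterBalance v := by
  rw [letterBalance, letterBalance, huv [0] (by simp), huv [1] (by simp)]

theorem positionBalance_eq (huv : binEq2 u v) : positionBalance u = positionBalance v := by
  rw [positionBalance, positionBalance, huv [0, 0] (by simp), huv [1, 0] (by simp),
    huv [0, 1] (by simp), huv [1, 1] (by simp)]

end binEq2

/-- The `n`-th letter of the fixed point of `h`. -/
def fixedLetter (n : ℕ) : Fin 2 :=
  if n % 3 = 0 then 0 else if n % 3 = 2 then 1 else fixedLetter (n / 3)
decreasing_by omega

theorem fixedLetter_three_mul (n : ℕ) : fixedLetter (3 * n) = 0 := by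
  rw [fixedLetter, if_pos (by omega)]

theorem fixedLetter_three_mul_add_one (n : ℕ) : fixedLetter (3 * n + 1) = fixedLetter n := by
  rw [fixedLetter, if_neg (by omega), if_neg (by omega)]
  congr 1
  omega

theorem fixedLetter_three_mul_add_two (n : ℕ) : fixedLetter (3 * n + 2) = 1 := by
  rw [fixedLetter, if_neg (by omega), if_pos (by omega)]

theorem h_eq (a : Fin 2) : h a = [0, a, 1] := by
  fin_cases a <;> rfl

theorem hWord_map_fixedLetter_range (n : ℕ) :
    hWord ((List.range n).map fixedLetter) = (List.range (3 * n)).map fixedLetter := by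
  induction n with
  | zero => rfl
  | succ n ih =>
    have append_eq (x y : List (Fin 2)) : hWord (x ++ y) = hWord x ++ hWord y :=
      List.flatMap_append
    rw [List.range_succ, List.map_append, append_eq, ih,
      show 3 * (n + 1) = 3 * n + 1 + 1 + 1 by ring, List.range_succ, List.range_succ, List.range_succ]
    simp [hWord, h_eq, fixedLetter_three_mul, fixedLetter_three_mul_add_one,
      fixedLetter_three_mul_add_two]

theorem hPow_eq_map_fixedLetter (n : ℕ) : hPow n = (List.range (3 ^ n)).map fixedLetter := by
  induction n with
  | zero => simp [hPow, fixedLetter_three_mul 0]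
  | succ n ih =>
    rw [hPow, Function.iterate_succ_apply', ← hPow, ih, hWord_map_fixedLetter_range, pow_succ']

theorem eq_map_fixedLetter_of_append_eq {a u b : List (Fin 2)} {n : ℕ}
    (hn : a ++ u ++ b = (List.range n).map fixedLetter) :
    u = (List.range' a.length u.length).map fixedLetter := by
  have hlen := congrArg List.length hn
  simp only [List.length_append, List.length_map, List.length_range] at hlen
  apply List.ext_getElem (by simp)
  intro i hi _
  have key : (a ++ u ++ b)[a.length + i]'(by simp; omega) = fixedLetter (a.length + i) := by
    simp [hn]
  rw [List.getElem_append_left (by simp; omega), List.getElem_append_right (by omega)] at key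
  simpa using key

/-- The balance of the prefix of length `n` of the fixed point of `h`. -/
def prefixBalance (n : ℕ) : ℤ := ∑ i ∈ Finset.range n, letterSign (fixedLetter i)

/-- The signed sum of the positions in the prefix of length `n` of the fixed point of `h`. -/
def prefixPositionBalance (n : ℕ) : ℤ := ∑ i ∈ Finset.range n, i * letterSign (fixedLetter i)

theorem prefixBalance_succ (n : ℕ) :
    prefixBalance (n + 1) = prefixBalance n + letterSign (fixedLetter n) :=
  Finset.sum_range_succ _ _

theorem prefixPositionBalance_succ (n : ℕ) :
    prefixPositionBalance (n + 1) = prefixPositionBalance n + n * letterSign (fixedLetter n) :=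
  Finset.sum_range_succ _ _

theorem letterBalance_factor (p L : ℕ) :
    letterBalance ((List.range' p L).map fixedLetter) =
      prefixBalance (p + L) - prefixBalance p := by
  induction L generalizing p with
  | zero => simp [letterBalance, binomC_nil_cons]
  | succ L ih =>
    rw [List.range'_succ, List.map_cons, letterBalance_cons, ih, prefixBalance_succ,
      show p + (L + 1) = p + 1 + L by ring]
    ring

theorem positionBalance_factor (p L : ℕ) :
    positionBalance ((List.range' p L).map fixedLetter) =
      prefixPositionBalance (p + L) - prefixPositionBalance p -
        p * (prefixBalance (p + L) - prefixBalance p) := by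
  induction L generalizing p with
  | zero => simp [positionBalance, binomC_nil_cons]
  | succ L ih =>
    rw [List.range'_succ, List.map_cons, positionBalance_cons, ih, letterBalance_factor,
      prefixPositionBalance_succ, prefixBalance_succ, show p + (L + 1) = p + 1 + L by ring]
    push_cast
    ring

theorem prefixBalance_three_mul (n : ℕ) : prefixBalance (3 * n) = prefixBalance n := by
  induction n with
  | zero => rfl
  | succ n ih =>
    rw [show 3 * (n + 1) = 3 * n + 2 + 1 by ring, prefixBalance_succ,
      prefixBalance_succ (3 * n + 1), prefixBalance_succ, prefixBalance_succ, ih, fixedLetter_three_mul,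
      fixedLetter_three_mul_add_one, fixedLetter_three_mul_add_two]
    simp only [letterSign_zero, letterSign_one]
    ring

theorem prefixBalance_three_mul_add_one (n : ℕ) :
    prefixBalance (3 * n + 1) = prefixBalance n + 1 := by
  rw [prefixBalance_succ, prefixBalance_three_mul, fixedLetter_three_mul]
  rfl

theorem prefixBalance_three_mul_add_two (n : ℕ) :
    prefixBalance (3 * n + 2) = prefixBalance (n + 1) + 1 := by
  rw [prefixBalance_succ, prefixBalance_three_mul_add_one, fixedLetter_three_mul_add_one,
    prefixBalance_succ]
  ring

theorem prefixPositionBalance_three_mul (n : ℕ) :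
    prefixPositionBalance (3 * n) = 3 * prefixPositionBalance n + prefixBalance n - 2 * n := by
  induction n with
  | zero => rfl
  | succ n ih =>
    rw [show 3 * (n + 1) = 3 * n + 2 + 1 by ring, prefixPositionBalance_succ,
      prefixPositionBalance_succ (3 * n + 1), prefixPositionBalance_succ,
      prefixPositionBalance_succ, prefixBalance_succ, ih, fixedLetter_three_mul,
      fixedLetter_three_mul_add_one, fixedLetter_three_mul_add_two]
    rw [letterSign_zero, letterSign_one]
    push_cast
    ring

theorem prefixPositionBalance_three_mul_add_one (n : ℕ) :
    prefixPositionBalance (3 * n + 1) = 3 * prefixPositionBalance n + prefixBalance n + n := by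
  rw [prefixPositionBalance_succ, prefixPositionBalance_three_mul, fixedLetter_three_mul]
  rw [letterSign_zero]
  push_cast
  ring

theorem prefixPositionBalance_three_mul_add_two (n : ℕ) :
    prefixPositionBalance (3 * n + 2) =
      3 * prefixPositionBalance (n + 1) + prefixBalance (n + 1) + n := by
  rw [prefixPositionBalance_succ, prefixPositionBalance_three_mul_add_one,
    fixedLetter_three_mul_add_one, prefixPositionBalance_succ, prefixBalance_succ]
  push_cast
  ring

/-- Adjacent factors of length `L` starting at `p` and `p + L` agree in balance and in signed sum
of positions. -/
def BalancedSquare (p L : ℕ) : Prop :=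
  prefixBalance (p + 2 * L) - 2 * prefixBalance (p + L) + prefixBalance p = 0 ∧
    prefixPositionBalance (p + 2 * L) - 2 * prefixPositionBalance (p + L) +
      prefixPositionBalance p = L * (prefixBalance (p + L) - prefixBalance p)

theorem balancedSquare_of_binEq2 {p L : ℕ}
    (hb : binEq2 ((List.range' p L).map fixedLetter) ((List.range' (p + L) L).map fixedLetter)) :
    BalancedSquare p L := by
  have h1 := hb.letterBalance_eq
  have h2 := hb.positionBalance_eq
  simp only [letterBalance_factor, positionBalance_factor] at h1 h2
  rw [show p + L + L = p + 2 * L by ring] at h1 h2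
  refine ⟨by linarith, ?_⟩
  push_cast at h2
  linear_combination -h2 - (p + L : ℤ) * h1

/-- A balanced square whose period is a multiple of `3` desubstitutes. -/
theorem BalancedSquare.of_three_mul {p k : ℕ} (hs : BalancedSquare p (3 * k)) :
    BalancedSquare ((p + 1) / 3) k := by
  obtain ⟨h1, h2⟩ := hs
  obtain ⟨m, rfl | rfl | rfl⟩ : ∃ m, p = 3 * m ∨ p = 3 * m + 1 ∨ p = 3 * m + 2 :=
    ⟨p / 3, by omega⟩
  · rw [show 3 * m + 2 * (3 * k) = 3 * (m + 2 * k) by ring,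
      show 3 * m + 3 * k = 3 * (m + k) by ring] at h1 h2
    rw [show (3 * m + 1) / 3 = m by omega]
    simp only [prefixBalance_three_mul, prefixPositionBalance_three_mul] at h1 h2
    push_cast at h1 h2
    exact ⟨by linarith, by linarith⟩
  · rw [show 3 * m + 1 + 2 * (3 * k) = 3 * (m + 2 * k) + 1 by ring,
      show 3 * m + 1 + 3 * k = 3 * (m + k) + 1 by ring] at h1 h2
    rw [show (3 * m + 1 + 1) / 3 = m by omega]
    simp only [prefixBalance_three_mul_add_one, prefixPositionBalance_three_mul_add_one] at h1 h2
    push_cast at h1 h2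
    exact ⟨by linarith, by linarith⟩
  · rw [show 3 * m + 2 + 2 * (3 * k) = 3 * (m + 2 * k) + 2 by ring,
      show 3 * m + 2 + 3 * k = 3 * (m + k) + 2 by ring] at h1 h2
    rw [show (3 * m + 2 + 1) / 3 = m + 1 by omega]
    simp only [prefixBalance_three_mul_add_two, prefixPositionBalance_three_mul_add_two,
      show m + 2 * k + 1 = m + 1 + 2 * k by ring, show m + k + 1 = m + 1 + k by ring] at h1 h2
    push_cast at h1 h2
    exact ⟨by linarith, by linarith⟩

theorem prefixPositionBalance_modEq (n : ℕ) :
    prefixPositionBalance n ≡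
      prefixBalance n + (n / 3 : ℕ) - (if n % 3 = 0 then 0 else 1) [ZMOD 3] := by
  obtain ⟨m, rfl | rfl | rfl⟩ : ∃ m, n = 3 * m ∨ n = 3 * m + 1 ∨ n = 3 * m + 2 :=
    ⟨n / 3, by omega⟩
  · rw [prefixPositionBalance_three_mul, prefixBalance_three_mul, if_pos (by omega)]
    unfold Int.ModEq
    omega
  · rw [prefixPositionBalance_three_mul_add_one, prefixBalance_three_mul_add_one,
      if_neg (by omega)]
    unfold Int.ModEq
    omega
  · rw [prefixPositionBalance_three_mul_add_two, prefixBalance_three_mul_add_two,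
      if_neg (by omega)]
    unfold Int.ModEq
    omega

/-- The period of two consecutive balanced squares is a multiple of `3`. -/
theorem BalancedSquare.three_dvd {p L : ℕ} (hs : BalancedSquare p L)
    (hs' : BalancedSquare (p + L) L) : 3 ∣ L := by
  obtain ⟨h1, h2⟩ := hs
  obtain ⟨h3, h4⟩ := hs'
  rw [show p + L + L = p + 2 * L by ring, show p + L + 2 * L = p + 3 * L by ring] at h3 h4
  rw [show prefixBalance (p + 2 * L) - prefixBalance (p + L) =
    prefixBalance (p + L) - prefixBalance p by linarith, ← h2] at h4
  have m0 := prefixPositionBalance_modEq p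
  have m1 := prefixPositionBalance_modEq (p + L)
  have m2 := prefixPositionBalance_modEq (p + 2 * L)
  have m3 := prefixPositionBalance_modEq (p + 3 * L)
  unfold Int.ModEq at m0 m1 m2 m3
  generalize prefixPositionBalance p = w0 at *
  generalize prefixPositionBalance (p + L) = w1 at *
  generalize prefixPositionBalance (p + 2 * L) = w2 at *
  generalize prefixPositionBalance (p + 3 * L) = w3 at *
  clear h2
  have hp : p % 3 = 0 ∨ p % 3 = 1 ∨ p % 3 = 2 := by omega
  have hL : L % 3 = 0 ∨ L % 3 = 1 ∨ L % 3 = 2 := by omega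
  rcases hL with hL | hL | hL
  · omega
  all_goals
    exfalso
    rcases hp with hp | hp | hp <;>
      simp [Nat.add_mod, Nat.mul_mod, hp, hL] at m0 m1 m2 m3 <;> omega

theorem not_balancedSquare_consecutive {p L : ℕ} (hL : 0 < L) (hs : BalancedSquare p L)
    (hs' : BalancedSquare (p + L) L) : False := by
  induction L using Nat.strong_induction_on generalizing p with
  | _ L ih =>
    obtain ⟨k, rfl⟩ := hs.three_dvd hs'
    have hk := hs'.of_three_mul
    rw [show (p + 3 * k + 1) / 3 = (p + 1) / 3 + k by omega] at hk
    exact ih k (by omega) (by omega) hs.of_three_mul hk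

/-- The fixed point of h avoids 2-binomial cubes. -/
theorem fixed_point_of_h_avoids_2binomial_cubes
    (n : ℕ) (u v t : List (Fin 2)) (hu : u ≠ [])
    (hfac : (u ++ v ++ t) <:+: hPow n) (huv : binEq2 u v) (hvt : binEq2 v t) :
    False := by
  obtain ⟨a, b, hab⟩ := hfac
  rw [hPow_eq_map_fixedLetter] at hab
  have hu_eq := eq_map_fixedLetter_of_append_eq (a := a) (u := u) (b := v ++ t ++ b)
    (by simpa using hab)
  have hv_eq := eq_map_fixedLetter_of_append_eq (a := a ++ u) (u := v) (b := t ++ b)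
    (by simpa using hab)
  have ht_eq := eq_map_fixedLetter_of_append_eq (a := a ++ u ++ v) (u := t) (b := b)
    (by simpa using hab)
  have hlv := huv.length_eq
  have hlt := hvt.length_eq
  simp only [List.length_append, ← hlt, ← hlv] at hv_eq ht_eq
  rw [hu_eq, hv_eq] at huv
  rw [hv_eq, ht_eq] at hvt
  exact not_balancedSquare_consecutive (List.length_pos_iff.mpr hu)
    (balancedSquare_of_binEq2 huv) (balancedSquare_of_binEq2 hvt)
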